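/- arXiv:1602.04031 — 2 statements merged into one kernel-verified Lean document; each statement's English description precedes it below -/
import Mathlib

section
/- Let n ≥ 1 and r ≥ 1 be natural numbers with r ≤ n, let s be a natural number with 0 ≤ s ≤ n and s ≡ n (mod 2), and set ℓ = (n−s)/2. Then the number of lattice paths w of length n starting at height s which have exactly r zeros (i.e., exactly r indices i with 0 ≤ i ≤ n and w_i = 0) equals 2^{r−1} · ( C(n−r, n−ℓ−1) − C(n−r, n−ℓ) ). -/
/-- The height after `i` steps of the walk starting at height `s` whose `j`-th step is
`+1` if `σ j = true` and `−1` if `σ j = false`. -/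
def walk {n : ℕ} (s : ℤ) (σ : Fin n → Bool) (i : ℕ) : ℤ :=
  s + ∑ j : Fin n, if (j : ℕ) < i then (if σ j then 1 else -1) else 0

/-- The lattice paths of length `n` starting at height `s` (and ending at height `0`),
encoded by their step sequences. -/
def paths (n : ℕ) (s : ℤ) : Finset (Fin n → Bool) :=
  Finset.univ.filter (fun σ => walk s σ n = 0)

def cntZ : ℕ → ℕ → ℤ → ℤ
  | 0, r, s => if s = 0 ∧ r = 1 then 1 else 0
  | n + 1, r, s => if s = 0 then (if r = 0 then 0 else cntZ n (r - 1) 1 + cntZ n (r - 1) (-1))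
      else cntZ n r (s + 1) + cntZ n r (s - 1)

lemma cntZ_neg (n : ℕ) : ∀ (r : ℕ) (s : ℤ), cntZ n r (-s) = cntZ n r s := by
  induction n with
  | zero => intro r s; simp [cntZ]
  | succ n ih =>
    intro r s
    simp only [cntZ, neg_eq_zero]
    split_ifs
    · rfl
    · rfl
    · rw [show -s + 1 = -(s - 1) by ring, show -s - 1 = -(s + 1) by ring, ih, ih, add_comm]

lemma cntZ_zero (n : ℕ) : ∀ (s : ℤ), cntZ n 0 s = 0 := by
  induction n with
  | zero => intro s; simp [cntZ]
  | succ n ih => intro s; simp [cntZ, ih]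

lemma cntZ_far (n : ℕ) : ∀ (r : ℕ) (s : ℤ), (n : ℤ) < s → cntZ n r s = 0 := by
  induction n with
  | zero => intro r s h; simp at h; simp [cntZ, h.ne']
  | succ n ih =>
    intro r s h
    push_cast at h
    rw [cntZ, if_neg (by omega), ih _ _ (by omega), ih _ _ (by omega), add_zero]

lemma cntZ_big (n : ℕ) : ∀ (r : ℕ) (s : ℤ), n + 1 ≤ r → ¬ (n = 0 ∧ r = 1 ∧ s = 0) →
    cntZ n r s = 0 := by
  induction n with
  | zero =>
    intro r s h h'
    rw [cntZ, if_neg]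
    tauto
  | succ n ih =>
    intro r s h h'
    rw [cntZ]
    split_ifs with h1 h2
    · rfl
    · rw [ih _ _ (by omega) (by omega), ih _ _ (by omega) (by omega), add_zero]
    · rw [ih _ _ (by omega) (by omega), ih _ _ (by omega) (by omega), add_zero]

lemma cntZ_formula (n : ℕ) : ∀ (k l r : ℕ), n = k + l → l ≤ k → 1 ≤ r → r ≤ n →
    cntZ n r ((k : ℤ) - l) =
      2 ^ (r - 1) * (((n - r).choose (k - 1) : ℤ) - ((n - r).choose k : ℤ)) := by
  induction n with
  | zero => intro k l r _ _ h1 h2; omega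
  | succ n ih =>
    intro k l r hn hl h1 h2
    rcases hl.eq_or_lt with rfl | hl
    · rw [cntZ, if_pos (by ring), if_neg (by omega), show (-1 : ℤ) = -(1) by rfl, cntZ_neg]
      rcases h1.eq_or_lt with rfl | h1
      · have : n.choose (l - 1) = n.choose l := by
          rw [← Nat.choose_symm (show l ≤ n by omega)]
          congr 1; omega
        simp [cntZ_zero, this]
      · have := ih l (l - 1) (r - 1) (by omega) (by omega) (by omega) (by omega)
        rw [show ((l : ℤ) - ((l - 1 : ℕ) : ℤ)) = 1 by omega] at this
        rw [this, show n + 1 - r = n - (r - 1) by omega]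
        obtain ⟨t, rfl⟩ : ∃ t, r = t + 2 := ⟨r - 2, by omega⟩
        simp only [Nat.add_sub_cancel, show t + 2 - 1 = t + 1 by omega]
        ring
    · rw [cntZ, if_neg (by omega)]
      rcases h2.eq_or_lt with rfl | h2
      · rcases Nat.eq_zero_or_pos n with rfl | hn0
        · obtain ⟨rfl, rfl⟩ : k = 1 ∧ l = 0 := by omega
          simp [cntZ]
        · rw [cntZ_big _ _ _ (by omega) (by omega), cntZ_big _ _ _ (by omega) (by omega)]
          obtain ⟨t, rfl⟩ : ∃ t, k = t + 2 := ⟨k - 2, by omega⟩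
          simp
      · have e1 : cntZ n r ((k : ℤ) - l + 1) =
            2 ^ (r - 1) * (((n - r).choose (k - 1) : ℤ) - ((n - r).choose k : ℤ)) := by
          rcases Nat.eq_zero_or_pos l with rfl | hl0
          · rw [cntZ_far _ _ _ (by omega), Nat.choose_eq_zero_of_lt (by omega),
              Nat.choose_eq_zero_of_lt (by omega)]
            simp
          · have := ih k (l - 1) r (by omega) (by omega) h1 (by omega)
            rw [← this]; congr 1; omega
        have e2 := ih (k - 1) l r (by omega) (by omega) h1 (by omega)
        rw [show (((k - 1 : ℕ) : ℤ) - l) = (k : ℤ) - l - 1 by omega] at e2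
        rw [e1, e2]
        obtain ⟨t, rfl⟩ : ∃ t, k = t + 2 := ⟨k - 2, by omega⟩
        rw [show n + 1 - r = (n - r) + 1 by omega]
        simp only [show t + 2 - 1 = t + 1 by omega, Nat.add_sub_cancel]
        rw [Nat.choose_succ_succ (n - r) t, Nat.choose_succ_succ (n - r) (t + 1)]
        push_cast
        ring

lemma walk_zero {n : ℕ} (s : ℤ) (σ : Fin n → Bool) : walk s σ 0 = s := by simp [walk]

lemma walk_cons {n : ℕ} (s : ℤ) (b : Bool) (σ : Fin n → Bool) (i : ℕ) :
    walk s (Fin.cons b σ : Fin (n + 1) → Bool) (i + 1) = walk (s + if b then 1 else -1) σ i := by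
  simp [walk, Fin.sum_univ_succ, add_assoc]

def zerosZ {n : ℕ} (s : ℤ) (σ : Fin n → Bool) : ℕ :=
  ((Finset.range (n + 1)).filter (fun i => walk s σ i = 0)).card

lemma zerosZ_cons {n : ℕ} (s : ℤ) (b : Bool) (σ : Fin n → Bool) :
    zerosZ s (Fin.cons b σ : Fin (n + 1) → Bool) =
      zerosZ (s + if b then 1 else -1) σ + if s = 0 then 1 else 0 := by
  unfold zerosZ
  rw [Finset.card_filter, Finset.card_filter, Finset.sum_range_succ']
  simp only [walk_cons, walk_zero]

lemma sum_eq_cntZ (n : ℕ) : ∀ (r : ℕ) (s : ℤ),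
    (∑ σ : Fin n → Bool, if walk s σ n = 0 ∧ zerosZ s σ = r then (1 : ℤ) else 0) = cntZ n r s := by
  induction n with
  | zero =>
    intro r s
    simp only [Finset.univ_unique, Finset.sum_singleton, walk_zero, cntZ]
    by_cases h : s = 0
    · simp [h, zerosZ, walk_zero, Finset.filter_singleton, eq_comm]
    · simp [h]
  | succ n ih =>
    intro r s
    rw [← (Fin.consEquiv (fun _ : Fin (n + 1) => Bool)).sum_comp, Fintype.sum_prod_type]
    have hc : ∀ (b : Bool) (σ : Fin n → Bool),
        (Fin.consEquiv (fun _ : Fin (n + 1) => Bool)) (b, σ) = (Fin.cons b σ : Fin (n + 1) → Bool) :=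
      fun _ _ => rfl
    simp only [hc, walk_cons, zerosZ_cons, Fintype.sum_bool, cntZ]
    by_cases h : s = 0
    · subst h
      rcases r with _ | r
      · simp
      · simp [← ih]
    · simp [h, ← ih, sub_eq_add_neg]

/-- For `1 ≤ r ≤ n`, `s ≤ n`, `s ≡ n (mod 2)` and `ℓ = (n−s)/2`: the number of lattice
paths of length `n` starting at height `s` with exactly `r` zeros equals
`2^{r−1}·(C(n−r, n−ℓ−1) − C(n−r, n−ℓ))`. -/
theorem count_paths_with_r_zeros (n r s : ℕ) (hn : 1 ≤ n) (hr : 1 ≤ r) (hrn : r ≤ n)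
    (hs : s ≤ n) (hpar : s % 2 = n % 2) :
    (((paths n (s : ℤ)).filter (fun σ =>
        ((Finset.range (n + 1)).filter (fun i => walk (s : ℤ) σ i = 0)).card = r)).card : ℤ)
      = 2 ^ (r - 1) *
        (((n - r).choose (n - (n - s) / 2 - 1) : ℤ) - ((n - r).choose (n - (n - s) / 2) : ℤ)) := by
  have h := sum_eq_cntZ n r (s : ℤ)
  have h2 := cntZ_formula n (n - (n - s) / 2) ((n - s) / 2) r (by omega) (by omega) hr hrn
  rw [show (((n - (n - s) / 2 : ℕ) : ℤ) - (((n - s) / 2 : ℕ) : ℤ)) = (s : ℤ) by omega, ← h] at h2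
  rw [← h2, paths, Finset.filter_filter, Finset.card_filter]
  push_cast
  rfl
end

section
/- For every natural number n ≥ 0: (a) the expected number of up-to-zero situations of a random lattice path of length n, namely (1/(n+1)) · Σ_{ℓ=0}^{n} (1/C(n,ℓ)) · Σ_{w} #{ i : 1 ≤ i ≤ n, w_i = 0 and w_{i−1} = −1 } (inner sum over all lattice paths w of length n starting at height n−2ℓ), equals (1/2)·H^odd_n; and (b) the expected number of down-from-zero situations, namely (1/(n+1)) · Σ_{ℓ=0}^{n} (1/C(n,ℓ)) · Σ_{w} #{ i : 0 ≤ i ≤ n−1, w_i = 0 and w_{i+1} = −1 }, equals (1/2)·(H^odd_{n+1} − 1). -/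
/-- The odd harmonic number `H^odd_n = ∑_{m=1}^n [m odd]/m`. -/
def Hodd (n : ℕ) : ℚ := ∑ m ∈ Finset.Icc 1 n, if Odd m then (1 : ℚ) / m else 0

def stp (b : Bool) : ℤ := if b then 1 else -1

def suf {n : ℕ} (σ : Fin n → Bool) (i : ℕ) : ℤ :=
  ∑ j : Fin n, if i ≤ (j : ℕ) then stp (σ j) else 0

def ups {n : ℕ} (σ : Fin n → Bool) : ℕ := ∑ j : Fin n, if σ j then 1 else 0

def mu (n l : ℕ) : ℚ := 1 / (((n : ℚ) + 1) * (n.choose l : ℚ))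

lemma ups_le {n : ℕ} (σ : Fin n → Bool) : ups σ ≤ n := by
  unfold ups
  calc _ ≤ ∑ j : Fin n, 1 := Finset.sum_le_sum (fun j _ => by split_ifs <;> simp)
    _ = n := by simp

lemma suf_zero {n : ℕ} (σ : Fin n → Bool) : suf σ 0 = 2 * (ups σ : ℤ) - n := by
  have : (n : ℤ) = ∑ j : Fin n, 1 := by simp
  unfold suf ups
  rw [this]
  push_cast
  rw [Finset.mul_sum, ← Finset.sum_sub_distrib]
  refine Finset.sum_congr rfl fun j _ => ?_
  cases h : σ j <;> simp [stp]

lemma walk_suf {n : ℕ} (s : ℤ) (σ : Fin n → Bool) (i : ℕ) :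
    walk s σ i = s + suf σ 0 - suf σ i := by
  unfold walk suf
  rw [add_sub_assoc, ← Finset.sum_sub_distrib]
  congr 1
  refine Finset.sum_congr rfl fun j _ => ?_
  by_cases h : (j : ℕ) < i
  · simp [h, stp, not_le.mpr h]
  · simp [h, not_lt.mp h]

lemma suf_n {n : ℕ} (σ : Fin n → Bool) : suf σ n = 0 := by
  unfold suf
  refine Finset.sum_eq_zero fun j _ => ?_
  simp

lemma paths_eq (n l : ℕ) :
    paths n ((n : ℤ) - 2 * l) = Finset.univ.filter (fun σ => ups σ = l) := by
  unfold paths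
  ext σ
  simp only [Finset.mem_filter, Finset.mem_univ, true_and, walk_suf, suf_n, suf_zero]
  omega

lemma suf_cons {n : ℕ} (b : Bool) (τ : Fin n → Bool) (i : ℕ) :
    suf (Fin.cons b τ : Fin (n+1) → Bool) (i + 1) = suf τ i := by
  unfold suf
  rw [Fin.sum_univ_succ]
  simp

lemma suf_cons_zero {n : ℕ} (b : Bool) (τ : Fin n → Bool) :
    suf (Fin.cons b τ : Fin (n+1) → Bool) 0 = stp b + suf τ 0 := by
  unfold suf
  rw [Fin.sum_univ_succ]
  simp

lemma ups_cons {n : ℕ} (b : Bool) (τ : Fin n → Bool) :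
    ups (Fin.cons b τ : Fin (n+1) → Bool) = (if b then 1 else 0) + ups τ := by
  unfold ups
  rw [Fin.sum_univ_succ]
  simp

lemma sum_cons {n : ℕ} (f : (Fin (n+1) → Bool) → ℚ) :
    ∑ σ, f σ = ∑ τ : Fin n → Bool, (f (Fin.cons true τ) + f (Fin.cons false τ)) := by
  rw [← (Fin.consEquiv (fun _ : Fin (n+1) => Bool)).sum_comp, Fintype.sum_prod_type_right]
  simp [Fin.consEquiv]

lemma count_ups (n k : ℕ) :
    ∑ τ : Fin n → Bool, (if ups τ = k then (1:ℚ) else 0) = n.choose k := by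
  induction n generalizing k with
  | zero => 
    cases k <;> simp [ups]
  | succ n ih =>
    rw [sum_cons, Finset.sum_add_distrib]
    simp only [ups_cons]
    cases k with
    | zero =>
      have := ih 0
      simp at this
      simp [this]
    | succ k =>
      have h1 := ih k
      have h2 := ih (k+1)
      rw [Nat.choose_succ_succ]
      push_cast
      rw [← h1, ← h2]
      congr 1
      · refine Finset.sum_congr rfl fun τ _ => ?_
        have : (1 + ups τ = k + 1) ↔ ups τ = k := by omega
        simp [this]
      · simp

lemma mu_add (n l : ℕ) (h : l ≤ n) : mu (n+1) (1 + l) + mu (n+1) (0 + l) = mu n l := by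
  obtain ⟨m, rfl⟩ := Nat.exists_eq_add_of_le h
  have e1 := Nat.add_one_mul_choose_eq (l+m) l
  have e2 := Nat.choose_mul_succ_eq (l+m) l
  have e3 : l + m + 1 - l = m + 1 := by omega
  rw [e3] at e2
  have p0 : ((l+m).choose l : ℚ) ≠ 0 := by exact_mod_cast (Nat.choose_pos (by omega)).ne'
  have p1 : ((l+m+1).choose (l+1) : ℚ) ≠ 0 := by exact_mod_cast (Nat.choose_pos (by omega)).ne'
  have p2 : ((l+m+1).choose l : ℚ) ≠ 0 := by exact_mod_cast (Nat.choose_pos (by omega)).ne'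
  have q1 : (((l+m+1).choose (l+1) : ℕ) : ℚ) = (l+m+1) * (l+m).choose l / (l+1) := by
    rw [eq_div_iff (by positivity)]
    exact_mod_cast e1.symm
  have q2 : (((l+m+1).choose l : ℕ) : ℚ) = (l+m+1) * (l+m).choose l / (m+1) := by
    rw [eq_div_iff (by positivity)]
    have : (((l+m).choose l : ℕ):ℚ) * (l+m+1) = (l+m+1).choose l * (m+1) := by exact_mod_cast e2
    linarith
  unfold mu
  rw [add_comm 1 l, zero_add, q1, q2]
  push_cast
  have a1 : (l:ℚ)+m+1 ≠ 0 := by positivity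
  have a2 : (l:ℚ)+m+1+1 ≠ 0 := by positivity
  field_simp
  ring

def cnt (P : ℤ → ℤ → Prop) [∀ a b, Decidable (P a b)] {n : ℕ} (σ : Fin n → Bool) : ℚ :=
  ∑ i ∈ Finset.range n, if P (suf σ i) (suf σ (i+1)) then 1 else 0

def expct (P : ℤ → ℤ → Prop) [∀ a b, Decidable (P a b)] (n : ℕ) : ℚ :=
  ∑ σ : Fin n → Bool, mu n (ups σ) * cnt P σ

lemma cnt_cons (P : ℤ → ℤ → Prop) [∀ a b, Decidable (P a b)] {n : ℕ} (b : Bool)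
    (τ : Fin n → Bool) : cnt P (Fin.cons b τ : Fin (n+1) → Bool) =
      cnt P τ + if P (stp b + suf τ 0) (suf τ 0) then 1 else 0 := by
  unfold cnt
  rw [Finset.sum_range_succ']
  simp only [suf_cons, suf_cons_zero]

lemma expct_succ (P : ℤ → ℤ → Prop) [∀ a b, Decidable (P a b)] (n : ℕ) :
    expct P (n+1) = expct P n + ∑ τ : Fin n → Bool,
      (mu (n+1) (1 + ups τ) * (if P (1 + suf τ 0) (suf τ 0) then 1 else 0)
       + mu (n+1) (ups τ) * (if P (-1 + suf τ 0) (suf τ 0) then 1 else 0)) := by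
  unfold expct
  rw [sum_cons, ← Finset.sum_add_distrib]
  refine Finset.sum_congr rfl fun τ _ => ?_
  rw [cnt_cons, cnt_cons, ups_cons, ups_cons, ← mu_add n (ups τ) (ups_le τ)]
  simp only [stp, if_true, zero_add, Bool.false_eq_true, if_false]
  ring

lemma double_sum (n : ℕ) (f : ℕ → (Fin n → Bool) → ℚ) :
    (1 / ((n : ℚ) + 1)) * ∑ l ∈ Finset.range (n + 1),
          (1 / (n.choose l : ℚ)) * ∑ σ ∈ paths n ((n : ℤ) - 2 * l), f l σ
      = ∑ σ, mu n (ups σ) * f (ups σ) σ := by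
  simp only [paths_eq, Finset.sum_filter, Finset.mul_sum]
  rw [Finset.sum_comm]
  refine Finset.sum_congr rfl fun σ _ => ?_
  rw [Finset.sum_eq_single (ups σ)]
  · simp [mu]; ring
  · intro b _ hb
    simp [hb.symm]
  · intro h
    exact absurd (Finset.mem_range.mpr (Nat.lt_succ_of_le (ups_le σ))) h

lemma Hodd_succ (n : ℕ) : Hodd (n+1) = Hodd n + if Odd (n+1) then 1 / ((n:ℚ)+1) else 0 := by
  unfold Hodd
  rw [Finset.sum_Icc_succ_top (by omega)]
  push_cast
  rfl

lemma sum_ups (n k : ℕ) (c : ℚ) :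
    ∑ τ : Fin n → Bool, (if ups τ = k then c else 0) = n.choose k * c := by
  rw [← count_ups, Finset.sum_mul]
  simp

lemma expct_a (n : ℕ) : expct (fun a b => b = 0 ∧ a = 1) n = 1 / 2 * Hodd n := by
  induction n with
  | zero => simp [expct, cnt, Hodd]
  | succ n ih =>
    rw [expct_succ, ih, Hodd_succ, mul_add]
    congr 1
    simp only [suf_zero]
    rcases Nat.even_or_odd' n with ⟨k, rfl | rfl⟩
    · rw [if_pos ⟨k, rfl⟩]
      rw [show (1 / 2 * (1 / (((2 * k : ℕ):ℚ) + 1))) =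
        (2*k).choose k * mu (2*k+1) (1+k) from ?_, ← sum_ups]
      · refine Finset.sum_congr rfl fun τ _ => ?_
        by_cases h : ups τ = k
        · simp [h]
        · have h1 : ¬ (2 * (ups τ:ℤ) - (2*k:ℕ) = 0) := by omega
          simp only [h1, h]
          simp
      · have e1 := Nat.add_one_mul_choose_eq (2*k) k
        have p0 : ((2*k).choose k : ℚ) ≠ 0 := by exact_mod_cast (Nat.choose_pos (by omega)).ne'
        have q1 : (((2*k+1).choose (k+1) : ℕ) : ℚ) = (2*k+1) * (2*k).choose k / (k+1) := by
          rw [eq_div_iff (by positivity)]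
          exact_mod_cast e1.symm
        unfold mu
        rw [add_comm 1 k, q1]
        push_cast
        have : 2*(k:ℚ)+1+1 ≠ 0 := by positivity
        field_simp
        ring
    · rw [if_neg (by rw [Nat.not_odd_iff_even]; exact ⟨k+1, by ring⟩)]
      rw [mul_zero]
      refine Finset.sum_eq_zero fun τ _ => ?_
      have h1 : ¬ (2 * (ups τ:ℤ) - (2*k+1:ℕ) = 0) := by omega
      simp only [h1]
      simp

lemma expct_b (n : ℕ) : expct (fun a b => a = 0 ∧ b = 1) n = 1 / 2 * (Hodd (n+1) - 1) := by
  induction n with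
  | zero => simp [expct, cnt, Hodd]
  | succ n ih =>
    rw [expct_succ, ih, Hodd_succ (n+1), add_sub_right_comm, mul_add]
    congr 1
    simp only [suf_zero]
    rcases Nat.even_or_odd' n with ⟨k, rfl | rfl⟩
    · rw [if_neg (by rw [Nat.not_odd_iff_even]; exact ⟨k+1, by ring⟩)]
      rw [mul_zero]
      refine Finset.sum_eq_zero fun τ _ => ?_
      have h1 : ¬ (2 * (ups τ:ℤ) - (2*k:ℕ) = 1) := by omega
      simp only [h1]
      simp
    · rw [if_pos ⟨k+1, by ring⟩]
      rw [show (1 / 2 * (1 / (((2 * k + 1 + 1 : ℕ):ℚ) + 1))) =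
        (2*k+1).choose (k+1) * mu (2*k+1+1) (k+1) from ?_, ← sum_ups]
      · refine Finset.sum_congr rfl fun τ _ => ?_
        by_cases h : ups τ = k+1
        · have h1 : (2 * (ups τ:ℤ) - (2*k+1:ℕ) = 1) := by omega
          rw [h1, if_pos h, h]
          simp
        · have h1 : ¬ (2 * (ups τ:ℤ) - (2*k+1:ℕ) = 1) := by omega
          simp only [h1, h]
          simp
      · have e2 := Nat.choose_mul_succ_eq (2*k+1) (k+1)
        have e3 : 2*k+1+1-(k+1) = k+1 := by omega
        rw [e3] at e2
        have p0 : ((2*k+1).choose (k+1) : ℚ) ≠ 0 := by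
          exact_mod_cast (Nat.choose_pos (by omega)).ne'
        have q1 : (((2*k+1+1).choose (k+1) : ℕ) : ℚ) = 2 * (2*k+1).choose (k+1) := by
          have : (((2*k+1).choose (k+1) : ℕ) : ℚ) * (2*k+1+1) = (2*k+1+1).choose (k+1) * (k+1) := by
            exact_mod_cast e2
          have h : (k:ℚ)+1 ≠ 0 := by positivity
          apply mul_right_cancel₀ h
          linarith
        unfold mu
        rw [q1]
        push_cast
        have : 2*(k:ℚ)+1+1+1 ≠ 0 := by positivity
        field_simp

/-- (a) The expected number of up-to-zero situations of a random lattice path of length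
`n` is `(1/2)·H^odd_n`; (b) the expected number of down-from-zero situations is
`(1/2)·(H^odd_{n+1} − 1)`. -/
theorem expected_up_to_zero_and_down_from_zero (n : ℕ) :
    ((1 / ((n : ℚ) + 1)) *
        ∑ l ∈ Finset.range (n + 1),
          (1 / (n.choose l : ℚ)) *
            ∑ σ ∈ paths n ((n : ℤ) - 2 * l),
              (((Finset.Icc 1 n).filter (fun i =>
                  walk ((n : ℤ) - 2 * l) σ i = 0 ∧
                  walk ((n : ℤ) - 2 * l) σ (i - 1) = -1)).card : ℚ)
      = (1 / 2) * Hodd n) ∧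
    ((1 / ((n : ℚ) + 1)) *
        ∑ l ∈ Finset.range (n + 1),
          (1 / (n.choose l : ℚ)) *
            ∑ σ ∈ paths n ((n : ℤ) - 2 * l),
              (((Finset.range n).filter (fun i =>
                  walk ((n : ℤ) - 2 * l) σ i = 0 ∧
                  walk ((n : ℤ) - 2 * l) σ (i + 1) = -1)).card : ℚ)
      = (1 / 2) * (Hodd (n + 1) - 1)) := by
  constructor
  · rw [double_sum n (fun l σ => (((Finset.Icc 1 n).filter (fun i =>
                  walk ((n : ℤ) - 2 * l) σ i = 0 ∧
                  walk ((n : ℤ) - 2 * l) σ (i - 1) = -1)).card : ℚ)), ← expct_a]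
    unfold expct cnt
    refine Finset.sum_congr rfl fun σ _ => ?_
    congr 1
    rw [Finset.card_filter]
    push_cast
    have key := Finset.sum_Ico_add'
      (fun i => if suf σ i = 0 ∧ suf σ (i - 1) = 1 then (1:ℚ) else 0) 0 n 1
    simp only [Nat.add_sub_cancel] at key
    rw [Finset.range_eq_Ico, key]
    refine Finset.sum_congr (by ext; simp only [Finset.mem_Icc, Finset.mem_Ico]; omega) fun i _ => ?_
    simp only [walk_suf, suf_zero]
    congr 1
    apply propext
    omega
  · rw [double_sum n (fun l σ => (((Finset.range n).filter (fun i =>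
                  walk ((n : ℤ) - 2 * l) σ i = 0 ∧
                  walk ((n : ℤ) - 2 * l) σ (i + 1) = -1)).card : ℚ)), ← expct_b]
    unfold expct cnt
    refine Finset.sum_congr rfl fun σ _ => ?_
    congr 1
    rw [Finset.card_filter]
    push_cast
    refine Finset.sum_congr rfl fun i _ => ?_
    simp only [walk_suf, suf_zero]
    congr 1
    apply propext
    omega
end
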